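/- If X is a crowded completely metrizable space and A(X) = X × {0,1} is its Alexandroff duplicate (points (x,1) isolated; basic neighborhoods of (x,0) of the form (U × {0,1}) \ {(x,1)} for U a neighborhood of x in X), then the hyperspace S_c(A(X)) of nontrivial convergent sequences of A(X), with the Vietoris topology, is a Baire space. -/

import Mathlib

open Set TopologicalSpace Filter

/-- The Vietoris topology on collections of subsets of `X`. -/
def vietoris (X : Type*) [TopologicalSpace X] : TopologicalSpace (Set X) :=
  TopologicalSpace.generateFrom
    ({t | ∃ U : Set X, IsOpen U ∧ t = {S : Set X | S ⊆ U}} ∪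
     {t | ∃ U : Set X, IsOpen U ∧ t = {S : Set X | (S ∩ U).Nonempty}})

/-- The set `S` converges to `x`: `x ∈ S` and `S \ U` is finite for every open
neighborhood `U` of `x`. -/
def ConvTo {X : Type*} [TopologicalSpace X] (S : Set X) (x : X) : Prop :=
  x ∈ S ∧ ∀ U : Set X, IsOpen U → x ∈ U → (S \ U).Finite

/-- `S` is a nontrivial convergent sequence in `X`: a countably infinite closed set with a
unique non-isolated point `x` (all other points are isolated in `S`), converging to `x`. -/
def IsNCS (X : Type*) [TopologicalSpace X] (S : Set X) : Prop :=
  S.Infinite ∧ S.Countable ∧ IsClosed S ∧ ∃ x : X, ConvTo S x ∧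
    (∀ y ∈ S, y ≠ x → ∃ U : Set X, IsOpen U ∧ U ∩ S = {y}) ∧
    ¬ ∃ U : Set X, IsOpen U ∧ U ∩ S = {x}

/-- The hyperspace of nontrivial convergent sequences of `X`. -/
def Sc (X : Type*) [TopologicalSpace X] : Type _ :=
  {S : Set X // IsNCS X S}

instance (X : Type*) [TopologicalSpace X] : TopologicalSpace (Sc X) :=
  TopologicalSpace.induced (fun S : Sc X => S.1) (vietoris X)


/-- The topology of the Alexandroff duplicate on `X × Bool`: every point `(x, true)` is
isolated, and basic neighborhoods of `(x, false)` are the sets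
`(U × {false, true}) \ {(x, true)}` for `U` an open neighborhood of `x` in `X`. -/
def adTop (X : Type*) [TopologicalSpace X] : TopologicalSpace (X × Bool) where
  IsOpen U := ∀ x : X, (x, false) ∈ U →
    ∃ V : Set X, IsOpen V ∧ x ∈ V ∧ (V ×ˢ (Set.univ : Set Bool)) \ {(x, true)} ⊆ U
  isOpen_univ := fun x _ => ⟨Set.univ, isOpen_univ, trivial, fun _ _ => trivial⟩
  isOpen_inter := fun U W hU hW x hx => by
    obtain ⟨V₁, hV₁, hx₁, hs₁⟩ := hU x hx.1
    obtain ⟨V₂, hV₂, hx₂, hs₂⟩ := hW x hx.2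
    exact ⟨V₁ ∩ V₂, hV₁.inter hV₂, ⟨hx₁, hx₂⟩, fun p hp =>
      ⟨hs₁ ⟨⟨hp.1.1.1, hp.1.2⟩, hp.2⟩, hs₂ ⟨⟨hp.1.1.2, hp.1.2⟩, hp.2⟩⟩⟩
  isOpen_sUnion := fun s hs x hx => by
    obtain ⟨t, ht, hxt⟩ := hx
    obtain ⟨V, hV, hxV, hsub⟩ := hs t ht x hxt
    exact ⟨V, hV, hxV, fun p hp => ⟨t, ht, hsub hp⟩⟩

/-- The Alexandroff duplicate of `X`, as a type. -/
def AD (X : Type*) : Type _ := X × Bool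

instance (X : Type*) [TopologicalSpace X] : TopologicalSpace (AD X) := adTop X


namespace Stmt19

def mk {X : Type*} (x : X) (b : Bool) : AD X := (x, b)

theorem mk_inj {X : Type*} {x y : X} {a b : Bool} : mk x a = mk y b ↔ x = y ∧ a = b :=
  Prod.mk_inj

theorem ad_cases {X : Type*} (p : AD X) : ∃ x b, p = mk x b := ⟨p.1, p.2, rfl⟩

def up {X : Type*} (F : Set X) : Set (AD X) := (fun x => mk x true) '' F

def Wn {X : Type*} [MetricSpace X] (x : X) (r : ℝ) : Set (AD X) :=
  {p | ∃ y b, p = mk y b ∧ dist y x < r ∧ ¬ (y = x ∧ b = true)}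

theorem mk_mem_up {X : Type*} {F : Set X} {x : X} {b : Bool} :
    mk x b ∈ up F ↔ x ∈ F ∧ b = true := by
  unfold up
  constructor
  · rintro ⟨y, hy, h⟩
    rw [mk_inj] at h
    obtain ⟨rfl, rfl⟩ := h
    exact ⟨hy, rfl⟩
  · rintro ⟨h, rfl⟩
    exact ⟨x, h, rfl⟩

theorem mk_mem_Wn {X : Type*} [MetricSpace X] {x y : X} {r : ℝ} {b : Bool} :
    mk y b ∈ Wn x r ↔ dist y x < r ∧ ¬ (y = x ∧ b = true) := by
  constructor
  · rintro ⟨z, c, h, h'⟩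
    rw [mk_inj] at h
    obtain ⟨rfl, rfl⟩ := h
    exact h'
  · intro h
    exact ⟨y, b, rfl, h⟩

theorem isOpen_iff' {X : Type*} [MetricSpace X] {U : Set (AD X)} :
    IsOpen U ↔ ∀ x, mk x false ∈ U → ∃ r > 0, Wn x r ⊆ U := by
  constructor
  · intro h x hx
    obtain ⟨V, hV, hxV, hs⟩ := h x hx
    obtain ⟨r, hr, hb⟩ := Metric.isOpen_iff.1 hV x hxV
    refine ⟨r, hr, ?_⟩
    rintro _ ⟨y, b, rfl, h1, h2⟩
    refine hs ⟨⟨hb h1, trivial⟩, fun h => h2 ?_⟩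
    exact mk_inj.1 h
  · intro h x hx
    obtain ⟨r, hr, hb⟩ := h x hx
    refine ⟨Metric.ball x r, Metric.isOpen_ball, Metric.mem_ball_self hr, ?_⟩
    rintro ⟨y, b⟩ ⟨⟨h1, -⟩, h2⟩
    refine hb ⟨y, b, rfl, h1, fun h => h2 ?_⟩
    exact mk_inj.2 h

theorem Wn_mono {X : Type*} [MetricSpace X] {x : X} {r s : ℝ} (h : r ≤ s) :
    Wn x r ⊆ Wn x s := by
  rintro _ ⟨y, b, rfl, h1, h2⟩
  exact ⟨y, b, rfl, h1.trans_le h, h2⟩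

theorem isOpen_Wn {X : Type*} [MetricSpace X] (x : X) (r : ℝ) : IsOpen (Wn x r) := by
  rw [isOpen_iff']
  intro y hy
  rw [mk_mem_Wn] at hy
  rcases eq_or_ne y x with rfl | hne
  · exact ⟨r, by simpa using hy.1, subset_rfl⟩
  · refine ⟨min (r - dist y x) (dist y x), lt_min (by linarith [hy.1]) (dist_pos.2 hne), ?_⟩
    rintro _ ⟨z, b, rfl, h1, h2⟩
    rw [mk_mem_Wn]
    rw [lt_min_iff] at h1
    refine ⟨by linarith [dist_triangle z y x], ?_⟩
    rintro ⟨rfl, -⟩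
    rw [dist_comm] at h1
    exact lt_irrefl _ h1.2

theorem isOpen_up {X : Type*} [MetricSpace X] (F : Set X) : IsOpen (up F) := by
  rw [isOpen_iff']
  intro y hy
  simp [mk_mem_up] at hy

theorem exists_near {X : Type*} [MetricSpace X] (hc : ∀ x : X, ¬ IsOpen ({x} : Set X))
    (x : X) {r : ℝ} (hr : 0 < r) : ∃ y, y ≠ x ∧ dist y x < r := by
  by_contra! h
  apply hc x
  rw [Metric.isOpen_iff]
  rintro _ rfl
  refine ⟨r, hr, fun y hy => ?_⟩
  by_contra hne
  exact absurd hy (not_lt.2 (h y hne))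

theorem exists_top {X : Type*} [MetricSpace X] (hc : ∀ x : X, ¬ IsOpen ({x} : Set X))
    {U : Set (AD X)} (hU : IsOpen U) (hne : U.Nonempty) : ∃ y, mk y true ∈ U := by
  obtain ⟨p, hp⟩ := hne
  obtain ⟨x, b, rfl⟩ := ad_cases p
  cases b
  · obtain ⟨r, hr, h⟩ := isOpen_iff'.1 hU x hp
    obtain ⟨y, hy, hd⟩ := exists_near hc x hr
    exact ⟨y, h (mk_mem_Wn.2 ⟨hd, fun h => hy h.1⟩)⟩
  · exact ⟨x, hp⟩

/-- near `x` there are points avoiding a finite set -/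
theorem exists_avoid {X : Type*} [MetricSpace X] (hc : ∀ x : X, ¬ IsOpen ({x} : Set X))
    (x : X) {r : ℝ} (hr : 0 < r) {F : Set X} (hF : F.Finite) :
    ∃ y, y ∉ F ∧ y ≠ x ∧ dist y x < r := by
  have hcl : IsClosed (F \ {x}) := (hF.subset sdiff_subset).isClosed
  obtain ⟨s, hs, hb⟩ := Metric.isOpen_iff.1 hcl.isOpen_compl x (by simp)
  obtain ⟨y, hy, hd⟩ := exists_near hc x (lt_min hr hs)
  rw [lt_min_iff] at hd
  refine ⟨y, fun h => ?_, hy, hd.1⟩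
  exact hb hd.2 ⟨h, hy⟩

theorem vietoris_core {X : Type*} [MetricSpace X] (hc : ∀ x : X, ¬ IsOpen ({x} : Set X))
    (O : Set (Set (AD X))) (hO : @IsOpen _ (vietoris (AD X)) O) (S : Set (AD X)) (hS : S ∈ O) :
    ∃ U : Set (AD X), IsOpen U ∧ S ⊆ U ∧ ∀ N : Set (AD X), IsOpen N → S ⊆ N →
      ∃ F : Set X, F.Finite ∧ up F ⊆ N ∧ ∀ S' : Set (AD X), up F ⊆ S' → S' ⊆ U → S' ∈ O := by
  change TopologicalSpace.GenerateOpen _ O at hO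
  induction hO with
  | basic t ht =>
    rcases ht with ⟨V, hV, rfl⟩ | ⟨V, hV, rfl⟩
    · exact ⟨V, hV, hS, fun N _ _ => ⟨∅, finite_empty, by simp [up], fun S' _ h => h⟩⟩
    · refine ⟨univ, isOpen_univ, subset_univ _, fun N hN hSN => ?_⟩
      obtain ⟨p, hp, hpV⟩ := hS
      obtain ⟨y, hy⟩ := exists_top hc (hN.inter hV) ⟨p, hSN hp, hpV⟩
      refine ⟨{y}, finite_singleton _, by simpa [up] using hy.1, fun S' h _ => ?_⟩
      exact ⟨mk y true, h (by simp [up]), hy.2⟩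
  | univ => exact ⟨univ, isOpen_univ, subset_univ _, fun N _ _ =>
      ⟨∅, finite_empty, by simp [up], fun S' _ _ => trivial⟩⟩
  | inter s t _ _ ihs iht =>
    obtain ⟨U, hU, hSU, h1⟩ := ihs hS.1
    obtain ⟨V, hV, hSV, h2⟩ := iht hS.2
    refine ⟨U ∩ V, hU.inter hV, subset_inter hSU hSV, fun N hN hSN => ?_⟩
    obtain ⟨F, hF, hFN, h1⟩ := h1 N hN hSN
    obtain ⟨G, hG, hGN, h2⟩ := h2 N hN hSN
    refine ⟨F ∪ G, hF.union hG, ?_, fun S' h h' => ?_⟩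
    · unfold up at *
      rw [image_union]
      exact union_subset hFN hGN
    · unfold up at *
      rw [image_union, union_subset_iff] at h
      exact ⟨h1 S' h.1 (h'.trans inter_subset_left), h2 S' h.2 (h'.trans inter_subset_right)⟩
  | sUnion K _ ih =>
    obtain ⟨t, ht, hSt⟩ := hS
    obtain ⟨U, hU, hSU, h1⟩ := ih t ht hSt
    refine ⟨U, hU, hSU, fun N hN hSN => ?_⟩
    obtain ⟨F, hF, hFN, h1⟩ := h1 N hN hSN
    exact ⟨F, hF, hFN, fun S' h h' => ⟨t, ht, h1 S' h h'⟩⟩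

/-- the limit of a nontrivial convergent sequence is at level `false` -/
theorem exists_lim {X : Type*} [MetricSpace X] (S : Sc (AD X)) : ∃ x, mk x false ∈ S.1 := by
  obtain ⟨_, _, _, p, hp, _, hn⟩ := S.2
  obtain ⟨x, b, rfl⟩ := ad_cases p
  cases b
  · exact ⟨x, hp.1⟩
  · exfalso
    apply hn
    refine ⟨up {x}, isOpen_up _, ?_⟩
    ext q
    constructor
    · rintro ⟨h, -⟩
      simpa [up] using h
    · rintro rfl
      exact ⟨by simp [up], hp.1⟩

theorem core {X : Type*} [MetricSpace X] (hc : ∀ x : X, ¬ IsOpen ({x} : Set X))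
    (O : Set (Sc (AD X))) (hO : IsOpen O) (S : Sc (AD X)) (hS : S ∈ O)
    (N : Set (AD X)) (hN : IsOpen N) (hSN : S.1 ⊆ N) (F : Set X) (hF : F.Finite)
    (hFS : up F ⊆ S.1) :
    ∃ (F' : Set X) (x : X) (δ : ℝ), F'.Finite ∧ F ⊂ F' ∧ mk x false ∈ S.1 ∧ 0 < δ ∧
      up F' ⊆ N ∧ Wn x δ ⊆ N ∧
      ∀ S' : Sc (AD X), up F' ⊆ S'.1 → S'.1 ⊆ up F' ∪ Wn x δ → S' ∈ O := by
  obtain ⟨O', hO', rfl⟩ := hO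
  obtain ⟨U, hU, hSU, h⟩ := vietoris_core hc O' hO' S.1 hS
  obtain ⟨G, hG, hGN, h⟩ := h (U ∩ N) (hU.inter hN) (subset_inter hSU hSN)
  obtain ⟨x, hx⟩ := exists_lim S
  obtain ⟨δ, hδ, hW⟩ := isOpen_iff'.1 (hU.inter hN) x ⟨hSU hx, hSN hx⟩
  obtain ⟨y, hyF, hyx, hyd⟩ := exists_avoid hc x hδ (hF.union hG)
  have key : up (insert y (F ∪ G)) ⊆ U ∩ N := by
    rintro _ ⟨z, hz, rfl⟩
    rcases hz with rfl | hz | hz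
    · exact hW (mk_mem_Wn.2 ⟨hyd, fun h => hyx h.1⟩)
    · have := hFS (mk_mem_up.2 ⟨hz, rfl⟩)
      exact ⟨hSU this, hSN this⟩
    · exact hGN (mk_mem_up.2 ⟨hz, rfl⟩)
  refine ⟨insert y (F ∪ G), x, δ, (hF.union hG).insert y, ?_, hx, hδ,
    key.trans inter_subset_right, hW.trans inter_subset_right, ?_⟩
  · rw [ssubset_iff_of_subset (subset_union_left.trans (subset_insert _ _))]
    exact ⟨y, mem_insert _ _, fun h => hyF (Or.inl h)⟩
  · intro S' h1 h2
    refine h S'.1 (Subset.trans (image_mono ?_) h1) (h2.trans (union_subset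
      (key.trans inter_subset_left) (hW.trans inter_subset_left)))
    exact subset_union_right.trans (subset_insert _ _)

theorem isNCS_of {X : Type*} [MetricSpace X] (A : Set X) (x : X) (hA : A.Infinite)
    (hAc : A.Countable) (hconv : ∀ ε > 0, (A \ Metric.ball x ε).Finite) :
    IsNCS (AD X) (insert (mk x false) (up A)) := by
  have hinj : Function.Injective (fun x : X => mk x true) := fun a b h => (mk_inj.1 h).1
  have hI : (up A).Infinite := hA.image hinj.injOn
  have hfin : ∀ U : Set (AD X), IsOpen U → mk x false ∈ U →
      (insert (mk x false) (up A) \ U).Finite := by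
    intro U hU hx
    obtain ⟨r, hr, hW⟩ := isOpen_iff'.1 hU x hx
    refine ((((hconv r hr).insert x)).image (fun x => mk x true)).subset ?_
    rintro p ⟨hp, hpU⟩
    rcases hp with rfl | ⟨y, hy, rfl⟩
    · exact absurd hx hpU
    · refine ⟨y, ?_, rfl⟩
      by_contra hcon
      rw [mem_insert_iff, not_or] at hcon
      apply hpU
      apply hW
      refine mk_mem_Wn.2 ⟨?_, fun h => hcon.1 h.1⟩
      by_contra hd
      exact hcon.2 ⟨hy, hd⟩
  refine ⟨hI.mono (subset_insert _ _), (hAc.image _).insert _, ?_, mk x false,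
    ⟨mem_insert _ _, hfin⟩, ?_, ?_⟩
  · rw [← isOpen_compl_iff, isOpen_iff']
    intro y hy
    have hyx : y ≠ x := by
      rintro rfl
      exact hy (mem_insert _ _)
    have hpos : 0 < dist y x := dist_pos.2 hyx
    have hfin' := (hconv (dist y x / 2) (by linarith)).subset
      (sdiff_subset : (A \ Metric.ball x (dist y x / 2)) \ {y} ⊆ _)
    obtain ⟨s, hs, hb⟩ := Metric.isOpen_iff.1 hfin'.isClosed.isOpen_compl y (by simp)
    refine ⟨min s (dist y x / 2), lt_min hs (by linarith), ?_⟩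
    rintro _ ⟨z, b, rfl, h1, h2⟩ h3
    rw [lt_min_iff] at h1
    rcases h3 with h3 | h3
    · obtain ⟨rfl, rfl⟩ := mk_inj.1 h3
      rw [dist_comm] at h1
      linarith [h1.2]
    · obtain ⟨h4, rfl⟩ := mk_mem_up.1 h3
      refine hb h1.1 ⟨⟨h4, fun h5 => ?_⟩, fun h => h2 ⟨h, rfl⟩⟩
      rw [Metric.mem_ball] at h5
      have := dist_triangle y z x
      rw [dist_comm y z] at this
      linarith [h1.2]
  · rintro p hp hne
    rcases hp with rfl | ⟨y, hy, rfl⟩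
    · exact absurd rfl hne
    · refine ⟨up {y}, isOpen_up _, ?_⟩
      ext q
      constructor
      · rintro ⟨h, -⟩
        simpa [up] using h
      · rintro rfl
        exact ⟨by simp [up], Or.inr ⟨y, hy, rfl⟩⟩
  · rintro ⟨U, hU, h⟩
    have hx : mk x false ∈ U := by
      have : mk x false ∈ U ∩ insert (mk x false) (up A) := by rw [h]; rfl
      exact this.1
    have h2 := (hfin U hU hx).union (finite_singleton (mk x false))
    refine hI (h2.subset ?_)
    intro p hp
    by_cases hpU : p ∈ U
    · right
      rw [← h]
      exact ⟨hpU, Or.inr hp⟩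
    · exact Or.inl ⟨Or.inr hp, hpU⟩

theorem box_nonempty {X : Type*} [MetricSpace X] (hc : ∀ x : X, ¬ IsOpen ({x} : Set X))
    (F : Set X) (hF : F.Finite) (x : X) (r : ℝ) (hr : 0 < r) :
    ∃ S : Sc (AD X), up F ⊆ S.1 ∧ S.1 ⊆ up F ∪ Wn x r := by
  have : ∀ n : ℕ, ∃ y, y ≠ x ∧ dist y x < min r (1 / ((n : ℝ) + 1)) := fun n =>
    exists_near hc x (lt_min hr (by positivity))
  choose y hyx hyd using this
  have hlim : Tendsto y atTop (nhds x) := by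
    rw [tendsto_iff_dist_tendsto_zero]
    exact squeeze_zero (fun _ => dist_nonneg) (fun n => ((hyd n).trans_le (min_le_right _ _)).le)
      tendsto_one_div_add_atTop_nhds_zero_nat
  have hinf : (range y).Infinite := by
    intro hfin
    have := hfin.isClosed.mem_of_tendsto hlim (Eventually.of_forall fun n => mem_range_self n)
    obtain ⟨n, hn⟩ := this
    exact hyx n hn
  refine ⟨⟨_, isNCS_of (F ∪ range y) x (hinf.mono subset_union_right)
    (hF.countable.union (countable_range y)) ?_⟩, ?_, ?_⟩
  · intro ε hε
    obtain ⟨n, hn⟩ := Metric.tendsto_atTop.1 hlim ε hε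
    refine (hF.union ((finite_Iio n).image y)).subset ?_
    rintro z ⟨hz | ⟨k, rfl⟩, hzb⟩
    · exact Or.inl hz
    · right
      refine ⟨k, ?_, rfl⟩
      by_contra hk
      exact hzb (hn k (not_lt.1 hk))
  · exact (image_mono subset_union_left).trans (subset_insert _ _)
  · rintro p (rfl | ⟨z, hz | ⟨k, rfl⟩, rfl⟩)
    · right
      exact mk_mem_Wn.2 ⟨by simpa using hr, by simp⟩
    · exact Or.inl ⟨z, hz, rfl⟩
    · right
      exact mk_mem_Wn.2 ⟨(hyd k).trans_le (min_le_left _ _), fun h => hyx k h.1⟩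

structure St (X : Type*) where
  F : Set X
  x : X
  r : ℝ
  hF : F.Finite
  hr : 0 < r

def St.T {X : Type*} [MetricSpace X] (s : St X) : Set (AD X) := up s.F ∪ Wn s.x s.r

theorem isOpen_box {X : Type*} [MetricSpace X] (s : St X) :
    IsOpen {S : Sc (AD X) | up s.F ⊆ S.1 ∧ S.1 ⊆ s.T} := by
  have h1 : ∀ U : Set (AD X), IsOpen U → IsOpen {S : Sc (AD X) | S.1 ⊆ U} := fun U hU =>
    ⟨{S | S ⊆ U}, TopologicalSpace.GenerateOpen.basic _ (Or.inl ⟨U, hU, rfl⟩), rfl⟩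
  have h2 : ∀ U : Set (AD X), IsOpen U → IsOpen {S : Sc (AD X) | (S.1 ∩ U).Nonempty} :=
    fun U hU =>
    ⟨{S | (S ∩ U).Nonempty}, TopologicalSpace.GenerateOpen.basic _ (Or.inr ⟨U, hU, rfl⟩), rfl⟩
  have h3 : {S : Sc (AD X) | up s.F ⊆ S.1 ∧ S.1 ⊆ s.T} =
      (⋂ y ∈ s.F, {S : Sc (AD X) | (S.1 ∩ up {y}).Nonempty}) ∩ {S : Sc (AD X) | S.1 ⊆ s.T} := by
    ext S
    simp [up, Set.subset_def]
  rw [h3]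
  exact (s.hF.isOpen_biInter fun y _ => h2 _ (isOpen_up _)).inter
    (h1 _ ((isOpen_up _).union (isOpen_Wn _ _)))

theorem step {X : Type*} [MetricSpace X] (hc : ∀ x : X, ¬ IsOpen ({x} : Set X))
    (O : Set (Sc (AD X))) (hO : IsOpen O) (hd : Dense O) (s : St X) (ε : ℝ) (hε : 0 < ε) :
    ∃ s' : St X, s.F ⊂ s'.F ∧ s'.T ⊆ s.T ∧ s'.r ≤ ε ∧
      Metric.closedBall s'.x s'.r ⊆ Metric.ball s.x s.r ∧
      ∀ S' : Sc (AD X), up s'.F ⊆ S'.1 → S'.1 ⊆ s'.T → S' ∈ O := by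
  obtain ⟨S, hSb, hSO⟩ := hd.inter_open_nonempty _ (isOpen_box s)
    (box_nonempty hc s.F s.hF s.x s.r s.hr)
  obtain ⟨F', x, δ, hF', hFF, hx, hδ, hFN, hWN, h⟩ := core hc O hO S hSO s.T
    ((isOpen_up _).union (isOpen_Wn _ _)) hSb.2 s.F s.hF hSb.1
  have hxr : dist x s.x < s.r := by
    rcases hSb.2 hx with h | h
    · simp [mk_mem_up] at h
    · exact (mk_mem_Wn.1 h).1
  have hpos : 0 < min (min δ ε) ((s.r - dist x s.x) / 2) :=
    lt_min (lt_min hδ hε) (by linarith)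
  refine ⟨⟨F', x, min (min δ ε) ((s.r - dist x s.x) / 2), hF', hpos⟩, hFF, ?_, ?_, ?_, ?_⟩
  · exact union_subset hFN ((Wn_mono ((min_le_left _ _).trans (min_le_left _ _))).trans hWN)
  · exact (min_le_left _ _).trans (min_le_right _ _)
  · apply Metric.closedBall_subset_ball'
    have := min_le_right (min δ ε) ((s.r - dist x s.x) / 2)
    dsimp only
    linarith
  · intro S' h1 h2
    exact h S' h1 (h2.trans (union_subset_union_right _
      (Wn_mono ((min_le_left _ _).trans (min_le_left _ _)))))

theorem main {X : Type*} [MetricSpace X] [CompleteSpace X]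
    (hc : ∀ x : X, ¬ IsOpen ({x} : Set X)) : BaireSpace (Sc (AD X)) := by
  refine ⟨fun f hfo hfd => ?_⟩
  rw [dense_iff_inter_open]
  rintro O hO ⟨S₀, hS₀⟩
  obtain ⟨F₀, x₀, δ₀, hF₀, -, -, hδ₀, -, -, h₀⟩ := core hc O hO S₀ hS₀ univ isOpen_univ
    (subset_univ _) ∅ finite_empty (by simp [up])
  have hst := fun (n : ℕ) (s : St X) =>
    step hc (f n) (hfo n) (hfd n) s (1 / ((n : ℝ) + 1)) (by positivity)
  choose g hg1 hg2 hg3 hg4 hg5 using hst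
  let s : ℕ → St X := fun n => Nat.rec ⟨F₀, x₀, δ₀, hF₀, hδ₀⟩ (fun n t => g n t) n
  have hs : ∀ n, s (n + 1) = g n (s n) := fun n => rfl
  have hFm : StrictMono (fun n => (s n).F) := strictMono_nat_of_lt_succ fun n => by
    rw [hs]; exact hg1 _ _
  have hT : Antitone (fun n => (s n).T) := antitone_nat_of_succ_le fun n => by
    rw [hs]; exact hg2 _ _
  have hB : Antitone (fun n => Metric.closedBall (s n).x (s n).r) :=
    antitone_nat_of_succ_le fun n => by
      rw [hs]; exact (hg4 _ _).trans Metric.ball_subset_closedBall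
  have hr : Tendsto (fun n => (s n).r) atTop (nhds 0) := by
    rw [← tendsto_add_atTop_iff_nat 1]
    exact squeeze_zero (fun n => (s (n+1)).hr.le) (fun n => by rw [hs]; exact hg3 _ _)
      tendsto_one_div_add_atTop_nhds_zero_nat
  have hmem : ∀ n m, n ≤ m → (s m).x ∈ Metric.closedBall (s n).x (s n).r := fun n m h =>
    hB h (Metric.mem_closedBall_self (s m).hr.le)
  have hcau : CauchySeq (fun n => (s n).x) := by
    refine cauchySeq_of_le_tendsto_0 (fun n => (s n).r + (s n).r) (fun n m N hn hm => ?_)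
      (by simpa using hr.add hr)
    exact (dist_triangle_right _ _ (s N).x).trans (add_le_add (hmem N n hn) (hmem N m hm))
  obtain ⟨x, hx⟩ := cauchySeq_tendsto_of_complete hcau
  have hxc : ∀ n, x ∈ Metric.closedBall (s n).x (s n).r := fun n =>
    Metric.isClosed_closedBall.mem_of_tendsto hx
      ((eventually_ge_atTop n).mono fun m hm => hmem n m hm)
  have hxb : ∀ n, x ∈ Metric.ball (s n).x (s n).r := fun n => by
    have := hxc (n + 1)
    rw [hs] at this
    exact hg4 _ _ this
  have hsub : ∀ n, up (⋃ k, (s k).F) ⊆ (s n).T := by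
    rintro n _ ⟨y, hy, rfl⟩
    obtain ⟨k, hk⟩ := mem_iUnion.1 hy
    have : mk y true ∈ (s (max n k)).T :=
      Or.inl ⟨y, hFm.monotone (le_max_right n k) hk, rfl⟩
    exact hT (le_max_left n k) this
  have hinf : (⋃ k, (s k).F).Infinite := by
    intro hfin
    have h1 : (range fun n => (s n).F).Infinite := infinite_range_of_injective hFm.injective
    refine h1 (hfin.finite_subsets.subset ?_)
    rintro _ ⟨n, rfl⟩
    exact subset_iUnion (fun k => (s k).F) n
  have hN := isNCS_of (⋃ k, (s k).F) x hinf (countable_iUnion fun k => (s k).hF.countable) (by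
    intro ε hε
    obtain ⟨n, hn⟩ := ((hr.add hr).eventually_lt_const (by simpa using hε)).exists
    refine (s n).hF.subset ?_
    rintro y ⟨hy, hyb⟩
    rcases hsub n ⟨y, hy, rfl⟩ with h | h
    · exact (mk_mem_up.1 h).1
    · exfalso
      apply hyb
      have h1 := (mk_mem_Wn.1 h).1
      have h2 : dist x (s n).x < (s n).r := hxb n
      rw [Metric.mem_ball]
      linarith [dist_triangle_right y x (s n).x])
  have hbox : ∀ n, up (s n).F ⊆ insert (mk x false) (up (⋃ k, (s k).F)) ∧
      insert (mk x false) (up (⋃ k, (s k).F)) ⊆ (s n).T := by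
    intro n
    refine ⟨(image_mono (subset_iUnion (fun k => (s k).F) n)).trans (subset_insert _ _), ?_⟩
    rw [insert_subset_iff]
    exact ⟨Or.inr (mk_mem_Wn.2 ⟨hxb n, by simp⟩), hsub n⟩
  refine ⟨⟨_, hN⟩, h₀ _ (hbox 0).1 (hbox 0).2, mem_iInter.2 fun n => ?_⟩
  have := hbox (n + 1)
  rw [hs n] at this
  exact hg5 n (s n) _ this.1 this.2

end Stmt19

/-- If `X` is a crowded completely metrizable space, then the hyperspace
`S_c(A(X))` of nontrivial convergent sequences of the Alexandroff duplicate of `X` is a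
Baire space. -/
theorem stmt19 {X : Type*} [TopologicalSpace X] [Nonempty X]
    (hmet : ∃ m : MetricSpace X, m.toUniformSpace.toTopologicalSpace = ‹TopologicalSpace X› ∧
      @CompleteSpace X m.toUniformSpace)
    (hcrowded : ∀ x : X, ¬ IsOpen ({x} : Set X)) :
    BaireSpace (Sc (AD X)) := by
  obtain ⟨m, rfl, hcs⟩ := hmet
  exact Stmt19.main hcrowded
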